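/- arXiv:2506.15970 — 2 statements merged into one kernel-verified Lean document; each statement's English description precedes it below -/
import Mathlib

section
/- Let $X_1,\dots,X_n, X'_1,\dots,X'_{n'}$ ($n, n' \geq 1$) be independent and identically distributed nonnegative square-integrable real-valued random variables on a probability space, and let $M_n = \max(X_1,\dots,X_n)$, $M_{n'} = \max(X'_1,\dots,X'_{n'})$, and $M_{n+n'} = \max(X_1,\dots,X_n,X'_1,\dots,X'_{n'})$. Then $\mathbb{V}(M_{n+n'}) \geq \mathbb{V}(M_n) - \mathbb{E}(M_{n'})\left[2\,\mathbb{E}(M_n) + \mathbb{E}(M_{n'})\right]$, where $\mathbb{V}$ denotes variance. -/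
open MeasureTheory ProbabilityTheory

/-- A finite pointwise maximum of `L^p` functions is in `L^p`. -/
theorem memLp_finset_sup' {α ι : Type*} {m : MeasurableSpace α} {μ : Measure α}
    {p : ENNReal} {s : Finset ι} (hs : s.Nonempty) {f : ι → α → ℝ}
    (hf : ∀ i ∈ s, MemLp (f i) p μ) :
    MemLp (fun x => s.sup' hs fun i => f i x) p μ := by
  have h := Finset.sup'_induction hs f (p := fun g => MemLp g p μ)
    (fun _ h₁ _ h₂ => h₁.sup h₂) hf
  convert h using 2
  rw [Finset.sup'_apply]

/-- Theorem 1(ii), lower bound: with variance `V(Y) = E(Y²) - (E Y)²`, we have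
`V(M_{n+n'}) ≥ V(M_n) - E(M_{n'}) [2 E(M_n) + E(M_{n'})]`. -/
theorem variance_complete_max_lower_bound
    {Ω : Type*} [MeasureSpace Ω] [IsProbabilityMeasure (ℙ : Measure Ω)]
    {n n' : ℕ} (hn : 0 < n) (hn' : 0 < n')
    (X : Fin n → Ω → ℝ) (X' : Fin n' → Ω → ℝ)
    (hmeas : ∀ i, Measurable (Sum.elim X X' i))
    (hindep : iIndepFun (Sum.elim X X') ℙ)
    (hident : ∀ i j, Measure.map (Sum.elim X X' i) ℙ = Measure.map (Sum.elim X X' j) ℙ)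
    (hnonneg : ∀ i ω, 0 ≤ Sum.elim X X' i ω)
    (hsq : ∀ i, MemLp (Sum.elim X X' i) 2 ℙ)
    (Mn Mn' Mtot : Ω → ℝ)
    (hMn : ∀ ω, Mn ω =
      Finset.univ.sup' (Finset.univ_nonempty_iff.mpr ⟨⟨0, hn⟩⟩) (fun i => X i ω))
    (hMn' : ∀ ω, Mn' ω =
      Finset.univ.sup' (Finset.univ_nonempty_iff.mpr ⟨⟨0, hn'⟩⟩) (fun i => X' i ω))
    (hMtot : ∀ ω, Mtot ω =
      Finset.univ.sup' (Finset.univ_nonempty_iff.mpr ⟨Sum.inl ⟨0, hn⟩⟩)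
        (fun i => Sum.elim X X' i ω)) :
    (∫ ω, (Mn ω) ^ 2 ∂ℙ) - (∫ ω, Mn ω ∂ℙ) ^ 2
        - (∫ ω, Mn' ω ∂ℙ) * (2 * (∫ ω, Mn ω ∂ℙ) + ∫ ω, Mn' ω ∂ℙ)
      ≤ (∫ ω, (Mtot ω) ^ 2 ∂ℙ) - (∫ ω, Mtot ω ∂ℙ) ^ 2 := by
  have hLn : MemLp Mn 2 ℙ := by
    rw [funext hMn]
    exact memLp_finset_sup' _ fun i _ => hsq (Sum.inl i)
  have hLn' : MemLp Mn' 2 ℙ := by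
    rw [funext hMn']
    exact memLp_finset_sup' _ fun i _ => hsq (Sum.inr i)
  have hLtot : MemLp Mtot 2 ℙ := by
    rw [funext hMtot]
    exact memLp_finset_sup' _ fun i _ => hsq i
  have hn_nonneg (ω : Ω) : 0 ≤ Mn ω := by
    rw [hMn]
    exact Finset.le_sup'_of_le (fun i => X i ω) (b := ⟨0, hn⟩) (Finset.mem_univ _)
      (hnonneg (Sum.inl ⟨0, hn⟩) ω)
  have hn'_nonneg (ω : Ω) : 0 ≤ Mn' ω := by
    rw [hMn']
    exact Finset.le_sup'_of_le (fun i => X' i ω) (b := ⟨0, hn'⟩) (Finset.mem_univ _)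
      (hnonneg (Sum.inr ⟨0, hn'⟩) ω)
  have hle (ω : Ω) : Mn ω ≤ Mtot ω := by
    rw [hMn, hMtot]
    exact Finset.sup'_le _ _ fun i _ =>
      Finset.le_sup' (fun i => Sum.elim X X' i ω) (Finset.mem_univ (Sum.inl i))
  have hle_add (ω : Ω) : Mtot ω ≤ Mn ω + Mn' ω := by
    rw [hMtot]
    refine Finset.sup'_le _ _ fun i _ => ?_
    rcases i with i | i
    · have h : X i ω ≤ Mn ω := by
        rw [hMn]
        exact Finset.le_sup' (fun i => X i ω) (Finset.mem_univ i)
      exact h.trans (le_add_of_nonneg_right (hn'_nonneg ω))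
    · have h : X' i ω ≤ Mn' ω := by
        rw [hMn']
        exact Finset.le_sup' (fun i => X' i ω) (Finset.mem_univ i)
      exact h.trans (le_add_of_nonneg_left (hn_nonneg ω))
  have hsecond : ∫ ω, (Mn ω) ^ 2 ∂ℙ ≤ ∫ ω, (Mtot ω) ^ 2 ∂ℙ :=
    integral_mono hLn.integrable_sq hLtot.integrable_sq
      fun ω => pow_le_pow_left₀ (hn_nonneg ω) (hle ω) 2
  have hIn := hLn.integrable one_le_two
  have hIn' := hLn'.integrable one_le_two
  have hfirst : ∫ ω, Mtot ω ∂ℙ ≤ (∫ ω, Mn ω ∂ℙ) + ∫ ω, Mn' ω ∂ℙ := by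
    rw [← integral_add hIn hIn']
    exact integral_mono (hLtot.integrable one_le_two) (hIn.add hIn') hle_add
  have htot_nonneg : 0 ≤ ∫ ω, Mtot ω ∂ℙ :=
    integral_nonneg fun ω => (hn_nonneg ω).trans (hle ω)
  linarith [pow_le_pow_left₀ htot_nonneg hfirst 2,
    add_sq (∫ ω, Mn ω ∂ℙ) (∫ ω, Mn' ω ∂ℙ)]
end

section
/- Let $X_1,\dots,X_n, X'_1,\dots,X'_{n'}$ ($n, n' \geq 1$) be independent and identically distributed nonnegative square-integrable real-valued random variables on a probability space, and let $M_n = \max(X_1,\dots,X_n)$, $M_{n'} = \max(X'_1,\dots,X'_{n'})$, and $M_{n+n'} = \max(X_1,\dots,X_n,X'_1,\dots,X'_{n'})$. Then $\mathbb{V}(M_{n+n'}) \leq \mathbb{V}(M_n) + \mathbb{E}(M_{n'}^2)$, where $\mathbb{V}$ denotes variance. -/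
open MeasureTheory ProbabilityTheory

/-- The pointwise maximum of a finite nonempty family of `MemLp` functions is `MemLp`. -/
theorem MeasureTheory.MemLp.finset_sup' {α ι : Type*} [MeasurableSpace α] {μ : Measure α}
    {p : ENNReal} {s : Finset ι} (hs : s.Nonempty) {f : ι → α → ℝ}
    (hf : ∀ i ∈ s, MemLp (f i) p μ) :
    MemLp (fun a => s.sup' hs fun i => f i a) p μ := by
  have h : MemLp (s.sup' hs f) p μ :=
    Finset.sup'_induction (p := fun g => MemLp g p μ) hs f (fun _ h₁ _ h₂ => h₁.sup h₂) hf
  convert h using 1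
  ext a
  exact (Finset.sup'_apply hs f a).symm

/-- If a function `T` satisfies `0 ≤ A ≤ T` and `T ^ 2 ≤ A ^ 2 + B ^ 2` pointwise, then
`V(T) ≤ V(A) + E(B ^ 2)`. -/
theorem integral_sq_sub_sq_integral_le {α : Type*} [MeasurableSpace α] {μ : Measure α}
    [IsFiniteMeasure μ] {A B T : α → ℝ} (hA : MemLp A 2 μ) (hB : MemLp B 2 μ) (hT : MemLp T 2 μ)
    (hA0 : ∀ a, 0 ≤ A a) (hAT : ∀ a, A a ≤ T a) (hsq : ∀ a, T a ^ 2 ≤ A a ^ 2 + B a ^ 2) :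
    (∫ a, T a ^ 2 ∂μ) - (∫ a, T a ∂μ) ^ 2
      ≤ (∫ a, A a ^ 2 ∂μ) - (∫ a, A a ∂μ) ^ 2 + ∫ a, B a ^ 2 ∂μ := by
  have hmean : ∫ a, A a ∂μ ≤ ∫ a, T a ∂μ :=
    integral_mono (hA.integrable one_le_two) (hT.integrable one_le_two) hAT
  have hmean_sq : (∫ a, A a ∂μ) ^ 2 ≤ (∫ a, T a ∂μ) ^ 2 :=
    pow_le_pow_left₀ (integral_nonneg hA0) hmean 2
  have hsecond : ∫ a, T a ^ 2 ∂μ ≤ (∫ a, A a ^ 2 ∂μ) + ∫ a, B a ^ 2 ∂μ := by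
    rw [← integral_add hA.integrable_sq hB.integrable_sq]
    exact integral_mono hT.integrable_sq (hA.integrable_sq.add hB.integrable_sq) hsq
  linarith

/-- Theorem 1(ii), upper bound: with variance `V(Y) = E(Y²) - (E Y)²`, we have
`V(M_{n+n'}) ≤ V(M_n) + E(M_{n'}²)`. -/
theorem variance_complete_max_upper_bound
    {Ω : Type*} [MeasureSpace Ω] [IsProbabilityMeasure (ℙ : Measure Ω)]
    {n n' : ℕ} (hn : 0 < n) (hn' : 0 < n')
    (X : Fin n → Ω → ℝ) (X' : Fin n' → Ω → ℝ)
    (hmeas : ∀ i, Measurable (Sum.elim X X' i))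
    (hindep : iIndepFun (m := fun _ => Real.measurableSpace) (Sum.elim X X') ℙ)
    (hident : ∀ i j, Measure.map (Sum.elim X X' i) ℙ = Measure.map (Sum.elim X X' j) ℙ)
    (hnonneg : ∀ i ω, 0 ≤ Sum.elim X X' i ω)
    (hsq : ∀ i, MemLp (Sum.elim X X' i) 2 ℙ)
    (Mn Mn' Mtot : Ω → ℝ)
    (hMn : ∀ ω, Mn ω =
      Finset.univ.sup' (Finset.univ_nonempty_iff.mpr ⟨⟨0, hn⟩⟩) (fun i => X i ω))
    (hMn' : ∀ ω, Mn' ω =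
      Finset.univ.sup' (Finset.univ_nonempty_iff.mpr ⟨⟨0, hn'⟩⟩) (fun i => X' i ω))
    (hMtot : ∀ ω, Mtot ω =
      Finset.univ.sup' (Finset.univ_nonempty_iff.mpr ⟨Sum.inl ⟨0, hn⟩⟩)
        (fun i => Sum.elim X X' i ω)) :
    (∫ ω, (Mtot ω) ^ 2 ∂ℙ) - (∫ ω, Mtot ω ∂ℙ) ^ 2
      ≤ (∫ ω, (Mn ω) ^ 2 ∂ℙ) - (∫ ω, Mn ω ∂ℙ) ^ 2 + ∫ ω, (Mn' ω) ^ 2 ∂ℙ := by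
  have hA : MemLp Mn 2 ℙ :=
    funext hMn ▸ MemLp.finset_sup' _ fun i _ => hsq (.inl i)
  have hB : MemLp Mn' 2 ℙ :=
    funext hMn' ▸ MemLp.finset_sup' _ fun i _ => hsq (.inr i)
  have hT : MemLp Mtot 2 ℙ :=
    funext hMtot ▸ MemLp.finset_sup' _ fun i _ => hsq i
  have hA0 (ω : Ω) : 0 ≤ Mn ω := by
    rw [hMn]
    exact (hnonneg (.inl ⟨0, hn⟩) ω).trans
      (Finset.le_sup' (fun i => X i ω) (Finset.mem_univ _))
  refine integral_sq_sub_sq_integral_le hA hB hT hA0 (fun ω => ?_) fun ω => ?_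
  · rw [hMn, hMtot]
    exact Finset.sup'_le _ _ fun i _ =>
      Finset.le_sup' (fun i => Sum.elim X X' i ω) (Finset.mem_univ (Sum.inl i))
  · obtain ⟨i, -, hi⟩ := Finset.exists_mem_eq_sup'
      (Finset.univ_nonempty_iff.mpr ⟨Sum.inl ⟨0, hn⟩⟩) (fun i => Sum.elim X X' i ω)
    rw [hMtot, hi]
    have h0 := hnonneg i ω
    rcases i with i | i
    · have hle : X i ω ≤ Mn ω := by
        rw [hMn]
        exact Finset.le_sup' (fun i => X i ω) (Finset.mem_univ i)
      exact (pow_le_pow_left₀ h0 hle 2).trans (le_add_of_nonneg_right (sq_nonneg _))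
    · have hle : X' i ω ≤ Mn' ω := by
        rw [hMn']
        exact Finset.le_sup' (fun i => X' i ω) (Finset.mem_univ i)
      exact (pow_le_pow_left₀ h0 hle 2).trans (le_add_of_nonneg_left (sq_nonneg _))
end
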